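/- Let Z be a real N×T matrix and let R₁, R₂ be natural numbers with R := R₁ + R₂ satisfying R ≤ N and R ≤ T. Then the infimum over all real N×R₁ matrices λ̃ and all real T×R₂ matrices f̃ of Tr(M_λ̃ Z M_f̃ Zᵀ) equals Σ_{i=R+1}^{T} μ_i(ZᵀZ), the sum of the T − R smallest eigenvalues of ZᵀZ, and this infimum is attained. -/

import Mathlib

open Matrix

/-- `mu A i` is the `i`-th largest eigenvalue (counted with multiplicity, `i : Fin n`
indexed from `0`) of a real symmetric matrix `A` (junk value `0` if `A` is not symmetric). -/
noncomputable def mu {n : ℕ} (A : Matrix (Fin n) (Fin n) ℝ) (i : Fin n) : ℝ :=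
  if hA : A.IsHermitian then hA.eigenvalues ((Tuple.sort hA.eigenvalues) i.rev) else 0

/-- `IsProjOnto X P` says that `P` is the matrix of the orthogonal projection onto the
column space of `X`. (Then `M_X = 1 - P`.) -/
def IsProjOnto {N R : ℕ} (X : Matrix (Fin N) (Fin R) ℝ)
    (P : Matrix (Fin N) (Fin N) ℝ) : Prop :=
  Pᵀ = P ∧ P * P = P ∧ P * X = X ∧ ∃ Y : Matrix (Fin R) (Fin N) ℝ, P = X * Y

theorem exists_orthogonal_diagonalization {n : Type*} [Fintype n] [DecidableEq n]
    {A : Matrix n n ℝ} (hA : A.IsHermitian) :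
    ∃ V : Matrix n n ℝ, Vᵀ * V = 1 ∧ A = V * diagonal hA.eigenvalues * Vᵀ := by
  refine ⟨(hA.eigenvectorUnitary).1, ?_, ?_⟩
  · have := Unitary.coe_star_mul_self hA.eigenvectorUnitary
    rwa [star_eq_conjTranspose, conjTranspose_eq_transpose_of_trivial] at this
  · have := hA.spectral_theorem
    rw [Unitary.conjStarAlgAut_apply] at this
    exact this

/-- A symmetric matrix admits a symmetric generalized inverse `G` whose product with it has trace at
most its size. -/
theorem exists_symm_generalizedInverse {n : Type*} [Fintype n] [DecidableEq n]
    {A : Matrix n n ℝ} (hA : A.IsHermitian) :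
    ∃ G : Matrix n n ℝ, Gᵀ = G ∧ A * G * A = A ∧ G * A * G = G ∧
      trace (G * A) ≤ Fintype.card n := by
  obtain ⟨U, hUU, hS⟩ := exists_orthogonal_diagonalization hA
  generalize hA.eigenvalues = d at hS
  subst hS
  have key : ∀ a b : n → ℝ, (U * diagonal a * Uᵀ) * (U * diagonal b * Uᵀ)
      = U * diagonal (fun i => a i * b i) * Uᵀ := by
    intro a b
    rw [← diagonal_mul_diagonal]
    calc _ = U * diagonal a * (Uᵀ * U) * diagonal b * Uᵀ := by simp only [Matrix.mul_assoc]
      _ = _ := by rw [hUU]; simp only [Matrix.mul_assoc, Matrix.one_mul]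
  refine ⟨U * diagonal (fun i => (d i)⁻¹) * Uᵀ, ?_, ?_, ?_, ?_⟩
  · simp [Matrix.mul_assoc]
  · simp only [key, mul_inv_mul_cancel]
  · have h (x : ℝ) : x⁻¹ * x * x⁻¹ = x⁻¹ := by simpa using mul_inv_mul_cancel x⁻¹
    simp only [key, h]
  · rw [key, Matrix.mul_assoc, trace_mul_comm, Matrix.mul_assoc, hUU, Matrix.mul_one,
      trace_diagonal]
    calc _ ≤ ∑ _i : n, (1 : ℝ) := Finset.sum_le_sum fun i _ => inv_mul_le_one
      _ = _ := by simp

/-- Every matrix has an orthogonal projection onto its column space, of trace at most its number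
of columns. -/
theorem exists_orthogonalProjection_columns {m n : Type*} [Fintype m] [DecidableEq m] [Fintype n]
    [DecidableEq n] (X : Matrix m n ℝ) :
    ∃ P : Matrix m m ℝ, Pᵀ = P ∧ P * P = P ∧ P * X = X ∧ (∃ Y : Matrix n m ℝ, P = X * Y) ∧
      trace P ≤ Fintype.card n := by
  obtain ⟨G, hG, hAGA, hGAG, htr⟩ :=
    exists_symm_generalizedInverse (A := Xᵀ * X) (by simp [IsHermitian])
  refine ⟨X * G * Xᵀ, ?_, ?_, ?_, ⟨G * Xᵀ, Matrix.mul_assoc _ _ _⟩, ?_⟩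
  · simp [Matrix.mul_assoc, hG]
  · calc _ = X * (G * (Xᵀ * X) * G) * Xᵀ := by simp only [Matrix.mul_assoc]
      _ = _ := by rw [hGAG]
  · have h : Xᵀ * (X * G * Xᵀ * X - X) = 0 := by
      rw [Matrix.mul_sub, sub_eq_zero]
      simpa only [Matrix.mul_assoc] using hAGA
    rw [← sub_eq_zero]
    have h2 : (X * G * Xᵀ * X - X)ᴴ * (X * G * Xᵀ * X - X) = 0 := by
      rw [conjTranspose_eq_transpose_of_trivial]
      have : (X * G * Xᵀ * X - X)ᵀ = (Xᵀ * X * G - 1) * Xᵀ := by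
        simp [Matrix.mul_assoc, hG, Matrix.sub_mul]
      rw [this, Matrix.mul_assoc, h, Matrix.mul_zero]
    exact conjTranspose_mul_self_eq_zero.mp h2
  · rwa [Matrix.mul_assoc, trace_mul_comm, Matrix.mul_assoc]

/-- Spectral decomposition with the eigenvalues in decreasing order. -/
theorem exists_sorted_diagonalization {n : ℕ} {A : Matrix (Fin n) (Fin n) ℝ}
    (hA : A.IsHermitian) :
    Antitone (mu A) ∧ ∃ U : Matrix (Fin n) (Fin n) ℝ, Uᵀ * U = 1 ∧ U * Uᵀ = 1 ∧
      Uᵀ * A * U = diagonal (mu A) := by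
  have hmu : mu A = fun i => hA.eigenvalues (Tuple.sort hA.eigenvalues i.rev) := by
    ext i
    exact dif_pos hA
  refine ⟨?_, ?_⟩
  · intro i j hij
    rw [hmu]
    exact Tuple.monotone_sort hA.eigenvalues (Fin.rev_le_rev.mpr hij)
  · set e : Equiv.Perm (Fin n) := Fin.revPerm.trans (Tuple.sort hA.eigenvalues) with he
    obtain ⟨V, hVV, hS⟩ := exists_orthogonal_diagonalization hA
    have hD : Vᵀ * A * V = diagonal hA.eigenvalues := by
      calc _ = Vᵀ * (V * diagonal hA.eigenvalues * Vᵀ) * V := by rw [← hS]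
        _ = (Vᵀ * V) * diagonal hA.eigenvalues * (Vᵀ * V) := by simp only [Matrix.mul_assoc]
        _ = _ := by rw [hVV, Matrix.one_mul, Matrix.mul_one]
    have hU : (V.submatrix id e)ᵀ * V.submatrix id e = 1 := by
      rw [transpose_submatrix, ← submatrix_mul _ _ _ _ _ Function.bijective_id, hVV,
        submatrix_one_equiv]
    refine ⟨V.submatrix id e, hU, mul_eq_one_comm.mp hU, ?_⟩
    have : (V.submatrix id e)ᵀ * A * V.submatrix id e = (Vᵀ * A * V).submatrix e e := by
      ext i j
      simp [Matrix.mul_apply]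
    rw [this, hD, hmu]
    ext i j
    simp [diagonal_apply, he]

theorem trace_mul_transpose_self_nonneg {m n : Type*} [Fintype m] [Fintype n]
    (B : Matrix m n ℝ) : 0 ≤ trace (B * Bᵀ) := by
  simp only [trace, diag, mul_apply, transpose_apply]
  exact Finset.sum_nonneg fun i _ => Finset.sum_nonneg fun j _ => mul_self_nonneg _

theorem diag_mem_Icc_of_symm_idempotent {n : Type*} [Fintype n] {K : Matrix n n ℝ}
    (hs : Kᵀ = K) (hi : K * K = K) (i : n) : 0 ≤ K i i ∧ K i i ≤ 1 := by
  have h : K i i = ∑ j, K i j * K i j := by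
    conv_lhs => rw [← hi, mul_apply]
    refine Finset.sum_congr rfl fun j _ => ?_
    exact congrArg (K i j * ·) (congrFun (congrFun hs i) j)
  have h1 : K i i * K i i ≤ K i i := by
    conv_rhs => rw [h]
    exact Finset.single_le_sum (f := fun j => K i j * K i j) (fun j _ => mul_self_nonneg _)
      (Finset.mem_univ i)
  have h0 : 0 ≤ K i i := by
    rw [h]
    exact Finset.sum_nonneg fun j _ => mul_self_nonneg _
  exact ⟨h0, by nlinarith⟩

theorem sum_tail_le_sum_mul_of_antitone {n r : ℕ} (hr : r ≤ n) {m p : Fin n → ℝ}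
    (hm : Antitone m) (hm0 : ∀ i, 0 ≤ m i) (hp0 : ∀ i, 0 ≤ p i) (hp1 : ∀ i, p i ≤ 1)
    (hp : (n : ℝ) - r ≤ ∑ i, p i) :
    ∑ i ∈ Finset.univ.filter (fun i : Fin n => r ≤ (i : ℕ)), m i ≤ ∑ i, p i * m i := by
  obtain ⟨c, hc0, hlt, hge⟩ : ∃ c : ℝ, 0 ≤ c ∧ (∀ i : Fin n, (i : ℕ) < r → c ≤ m i) ∧
      ∀ i : Fin n, r ≤ (i : ℕ) → m i ≤ c := by
    rcases hr.lt_or_eq with h | rfl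
    · exact ⟨m ⟨r, h⟩, hm0 _, fun i hi => hm (Fin.mk_le_mk.mpr hi.le),
        fun i hi => hm (Fin.mk_le_mk.mpr hi)⟩
    · exact ⟨0, le_rfl, fun i _ => hm0 i, fun i hi => absurd i.isLt (by omega)⟩
  have hcard : ∑ i : Fin n, (if r ≤ (i : ℕ) then (1 : ℝ) else 0) = n - r := by
    have h := Finset.card_filter_add_card_filter_not (s := Finset.univ)
      (fun i : Fin n => (i : ℕ) < r)
    simp only [not_lt, Finset.card_univ, Fintype.card_fin, Fin.card_filter_val_lt,
      min_eq_right hr] at h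
    rw [Finset.sum_boole, ← Nat.cast_sub hr]
    congr 1
    omega
  have key : 0 ≤ ∑ i : Fin n, (p i - if r ≤ (i : ℕ) then (1 : ℝ) else 0) * (m i - c) := by
    refine Finset.sum_nonneg fun i _ => ?_
    split_ifs with h
    · exact mul_nonneg_of_nonpos_of_nonpos (by linarith [hp1 i]) (by linarith [hge i h])
    · exact mul_nonneg (by linarith [hp0 i]) (by linarith [hlt i (not_le.mp h)])
  have hexp : ∑ i : Fin n, (p i - if r ≤ (i : ℕ) then (1 : ℝ) else 0) * (m i - c)
      = ∑ i, p i * m i - ∑ i ∈ Finset.univ.filter (fun i : Fin n => r ≤ (i : ℕ)), m i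
        - c * (∑ i, p i - (n - r)) := by
    rw [← hcard, Finset.sum_filter, ← Finset.sum_sub_distrib, ← Finset.sum_sub_distrib,
      Finset.mul_sum, ← Finset.sum_sub_distrib]
    refine Finset.sum_congr rfl fun i _ => ?_
    split_ifs <;> ring
  nlinarith [mul_nonneg hc0 (sub_nonneg.mpr hp)]

theorem mu_gram_nonneg {N T : ℕ} (Z : Matrix (Fin N) (Fin T) ℝ) (i : Fin T) :
    0 ≤ mu (Zᵀ * Z) i := by
  have hA : (Zᵀ * Z).PosSemidef := by
    simpa using posSemidef_conjTranspose_mul_self Z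
  simp only [mu, hA.isHermitian, dif_pos]
  exact hA.eigenvalues_nonneg _

/-- Ky Fan's inequality for a Gram matrix. -/
theorem sum_tail_mu_le_trace {N T r : ℕ} (hr : r ≤ T) (Z : Matrix (Fin N) (Fin T) ℝ)
    {W : Matrix (Fin T) (Fin T) ℝ} (hs : Wᵀ = W) (hi : W * W = W)
    (htr : (T : ℝ) - r ≤ trace W) :
    ∑ i ∈ Finset.univ.filter (fun i : Fin T => r ≤ (i : ℕ)), mu (Zᵀ * Z) i
      ≤ trace (Z * W * Zᵀ) := by
  obtain ⟨hanti, U, hU, hU', hD⟩ :=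
    exists_sorted_diagonalization (A := Zᵀ * Z) (by simp [IsHermitian])
  have hKs : (Uᵀ * W * U)ᵀ = Uᵀ * W * U := by simp [Matrix.mul_assoc, hs]
  have hKi : (Uᵀ * W * U) * (Uᵀ * W * U) = Uᵀ * W * U := by
    calc _ = Uᵀ * W * (U * Uᵀ) * W * U := by simp only [Matrix.mul_assoc]
      _ = Uᵀ * (W * W) * U := by rw [hU', Matrix.mul_one, Matrix.mul_assoc Uᵀ W W]
      _ = _ := by rw [hi]
  have hK := diag_mem_Icc_of_symm_idempotent hKs hKi
  have htrK : trace (Uᵀ * W * U) = trace W := by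
    rw [trace_mul_comm, ← Matrix.mul_assoc, hU', Matrix.one_mul]
  have hsum : trace (Z * W * Zᵀ) = ∑ i, (Uᵀ * W * U) i i * mu (Zᵀ * Z) i := by
    have : trace (Z * W * Zᵀ) = trace ((Uᵀ * W * U) * diagonal (mu (Zᵀ * Z))) := by
      rw [← hD]
      calc _ = trace (W * (Zᵀ * Z)) := by
            rw [Matrix.mul_assoc, trace_mul_comm, Matrix.mul_assoc]
        _ = trace ((U * Uᵀ) * W * (U * Uᵀ) * (Zᵀ * Z) * (U * Uᵀ)) := by
            simp only [hU', Matrix.one_mul, Matrix.mul_one]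
        _ = trace (U * (Uᵀ * W * U * (Uᵀ * (Zᵀ * Z) * U) * Uᵀ)) := by
            simp only [Matrix.mul_assoc]
        _ = _ := by rw [trace_mul_comm, Matrix.mul_assoc, hU, Matrix.mul_one]
    rw [this]
    simp [trace]
  rw [hsum]
  exact sum_tail_le_sum_mul_of_antitone hr hanti (mu_gram_nonneg Z) (fun i => (hK i).1)
    (fun i => (hK i).2) (by rw [← htrK] at htr; exact htr)

theorem one_sub_mul_one_sub_self {n : Type*} [Fintype n] [DecidableEq n] {P : Matrix n n ℝ}
    (hP : P * P = P) : (1 - P) * (1 - P) = 1 - P :=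
  (show IsIdempotentElem P from hP).one_sub

theorem mul_mul_transpose_of_symm_idempotent {m n : Type*} [Fintype n] {K : Matrix n n ℝ}
    (hs : Kᵀ = K) (hi : K * K = K) (B : Matrix m n ℝ) : (B * K) * (B * K)ᵀ = B * K * Bᵀ := by
  rw [transpose_mul, hs, ← Matrix.mul_assoc, Matrix.mul_assoc B K, hi]

theorem trace_sandwich_eq {m n : Type*} [Fintype m] [DecidableEq m] [Fintype n] [DecidableEq n]
    {P : Matrix m m ℝ} {Q : Matrix n n ℝ} (Z : Matrix m n ℝ)
    (hPs : Pᵀ = P) (hP : P * P = P) (hQs : Qᵀ = Q) (hQ : Q * Q = Q) :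
    trace ((1 - P) * Z * (1 - Q) * Zᵀ)
      = trace (((1 - P) * Z * (1 - Q)) * ((1 - P) * Z * (1 - Q))ᵀ) := by
  have h : ((1 - P) * Z * (1 - Q)) * ((1 - P) * Z * (1 - Q))ᵀ
      = (1 - P) * Z * ((1 - Q) * (1 - Q)) * Zᵀ * (1 - P) := by
    simp [Matrix.mul_assoc, hPs, hQs]
  rw [h, one_sub_mul_one_sub_self hQ, trace_mul_comm _ (1 - P)]
  simp only [← Matrix.mul_assoc]
  rw [one_sub_mul_one_sub_self hP]

theorem sum_tail_mu_le_trace_sandwich {N T R₁ R₂ : ℕ} (hRT : R₁ + R₂ ≤ T)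
    (Z : Matrix (Fin N) (Fin T) ℝ) {l : Matrix (Fin N) (Fin R₁) ℝ}
    {f : Matrix (Fin T) (Fin R₂) ℝ} {P : Matrix (Fin N) (Fin N) ℝ}
    {Q : Matrix (Fin T) (Fin T) ℝ} (hP : IsProjOnto l P) (hQ : IsProjOnto f Q) :
    ∑ i ∈ Finset.univ.filter (fun i : Fin T => R₁ + R₂ ≤ (i : ℕ)), mu (Zᵀ * Z) i
      ≤ trace ((1 - P) * Z * (1 - Q) * Zᵀ) := by
  obtain ⟨hPs, hPi, -, Y₁, hY₁⟩ := hP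
  obtain ⟨hQs, hQi, -, Y₂, hY₂⟩ := hQ
  obtain ⟨S, hSs, hSi, hSX, -, hStr⟩ := exists_orthogonalProjection_columns
    (fromCols (Zᵀ * l) f)
  rw [mul_fromCols, fromCols_inj.eq_iff] at hSX
  have hWs : (1 - S)ᵀ = 1 - S := by simp [hSs]
  have hWi := one_sub_mul_one_sub_self hSi
  have hPW : P * Z * (1 - S) = 0 := by
    have : (P * Z * (1 - S))ᵀ = (1 - S) * (Zᵀ * l) * Y₁ := by
      rw [transpose_mul, transpose_mul, hPs, hWs, hY₁]
      simp only [Matrix.mul_assoc]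
    rw [← transpose_eq_zero, this, Matrix.sub_mul, hSX.1, Matrix.one_mul, sub_self,
      Matrix.zero_mul]
  have hQW : Q * (1 - S) = 0 := by
    have : (Q * (1 - S))ᵀ = (1 - S) * f * Y₂ := by
      rw [transpose_mul, hQs, hWs, hY₂]
      simp only [Matrix.mul_assoc]
    rw [← transpose_eq_zero, this, Matrix.sub_mul, hSX.2, Matrix.one_mul, sub_self,
      Matrix.zero_mul]
  set B := (1 - P) * Z * (1 - Q) with hB
  have hBW : B * (1 - S) = Z * (1 - S) := by
    rw [hB, Matrix.mul_assoc _ (1 - Q), Matrix.sub_mul 1 Q, hQW, sub_zero, Matrix.one_mul,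
      Matrix.sub_mul, Matrix.one_mul, Matrix.sub_mul, hPW, sub_zero]
  have htrW : (T : ℝ) - (R₁ + R₂ : ℕ) ≤ trace (1 - S) := by
    rw [trace_sub, trace_one, Fintype.card_fin]
    simp only [Fintype.card_sum, Fintype.card_fin] at hStr
    linarith
  have h1 := sum_tail_mu_le_trace hRT Z hWs hWi htrW
  have h2 : Z * (1 - S) * Zᵀ = B * (1 - S) * Bᵀ := by
    rw [← mul_mul_transpose_of_symm_idempotent hWs hWi, ← hBW,
      mul_mul_transpose_of_symm_idempotent hWs hWi]
  have h3 : B * Bᵀ = B * (1 - S) * Bᵀ + (B * S) * (B * S)ᵀ := by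
    rw [mul_mul_transpose_of_symm_idempotent hSs hSi, Matrix.mul_sub, Matrix.sub_mul,
      Matrix.mul_one, sub_add_cancel]
  rw [trace_sandwich_eq Z hPs hPi hQs hQi, ← hB, h3, trace_add, ← h2]
  linarith [trace_mul_transpose_self_nonneg (B * S)]

theorem exists_trace_sandwich_le {N T R₁ R₂ : ℕ} (hRT : R₁ + R₂ ≤ T)
    (Z : Matrix (Fin N) (Fin T) ℝ) :
    ∃ (l : Matrix (Fin N) (Fin R₁) ℝ) (f : Matrix (Fin T) (Fin R₂) ℝ)
      (P : Matrix (Fin N) (Fin N) ℝ) (Q : Matrix (Fin T) (Fin T) ℝ),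
      IsProjOnto l P ∧ IsProjOnto f Q ∧ trace ((1 - P) * Z * (1 - Q) * Zᵀ)
        ≤ ∑ i ∈ Finset.univ.filter (fun i : Fin T => R₁ + R₂ ≤ (i : ℕ)), mu (Zᵀ * Z) i := by
  obtain ⟨-, U, hU, hU', hD⟩ :=
    exists_sorted_diagonalization (A := Zᵀ * Z) (by simp [IsHermitian])
  set a : Fin R₁ → Fin T := fun j => ⟨j, by omega⟩
  set b : Fin R₂ → Fin T := fun j => ⟨R₁ + j, by omega⟩ with hb
  obtain ⟨P, hPs, hPi, hPl, hPY, -⟩ := exists_orthogonalProjection_columns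
    ((Z * U).submatrix id a)
  obtain ⟨Q, hQs, hQi, hQf, hQY, -⟩ := exists_orthogonalProjection_columns (U.submatrix id b)
  refine ⟨(Z * U).submatrix id a, U.submatrix id b, P, Q, ⟨hPs, hPi, hPl, hPY⟩,
    ⟨hQs, hQi, hQf, hQY⟩, ?_⟩
  set e : Fin T → ℝ := fun j => if R₁ ≤ (j : ℕ) ∧ (j : ℕ) < R₁ + R₂ then 0 else 1 with he
  set t : Fin T → ℝ := fun j => if R₁ + R₂ ≤ (j : ℕ) then 1 else 0 with ht
  have hQU : (1 - Q) * U = U * diagonal e := by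
    ext i j
    rw [Matrix.sub_mul, Matrix.one_mul, Matrix.sub_apply, mul_diagonal]
    by_cases h : R₁ ≤ (j : ℕ) ∧ (j : ℕ) < R₁ + R₂
    · have hj : j = b ⟨j - R₁, by omega⟩ := Fin.ext (by simp only [hb]; omega)
      have := congrFun (congrFun hQf i) ⟨j - R₁, by omega⟩
      have hQ : (Q * U) i j = U i j := by
        rw [hj]
        exact this
      simp [he, h, hQ]
    · obtain ⟨Y, hY⟩ := hQY
      have hQ : Q * U = Yᵀ * ((U.submatrix id b)ᵀ * U) := by
        rw [← Matrix.mul_assoc, ← transpose_mul, ← hY, hQs]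
      have hz : (Q * U) i j = 0 := by
        rw [hQ, mul_apply]
        refine Finset.sum_eq_zero fun k _ => ?_
        have hk : ((U.submatrix id b)ᵀ * U) k j = (Uᵀ * U) (b k) j := rfl
        have hne : b k ≠ j := by
          rintro rfl
          exact h ⟨by simp [hb], by simp [hb]⟩
        rw [hk, hU, one_apply_ne hne, mul_zero]
      rw [hz]
      simp only [he, if_neg h, sub_zero, mul_one]
  have hL : (1 - P) * (Z * U) * diagonal e = (1 - P) * (Z * U) * diagonal t := by
    ext i j
    rw [mul_diagonal, mul_diagonal]
    by_cases h : (j : ℕ) < R₁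
    · have hz : (P * (Z * U)) i j = (Z * U) i j := congrFun (congrFun hPl i) ⟨j, h⟩
      rw [Matrix.sub_mul, Matrix.one_mul, Matrix.sub_apply, hz, sub_self, zero_mul, zero_mul]
    · congr 1
      simp only [he, ht]
      split_ifs <;> first | rfl | omega
  set C := Z * U * diagonal t with hC
  have hBU : (1 - P) * Z * (1 - Q) * U = (1 - P) * C := by
    rw [Matrix.mul_assoc _ (1 - Q), hQU, hC, ← Matrix.mul_assoc (1 - P) (Z * U), ← hL]
    simp only [Matrix.mul_assoc]
  have hBB : trace ((1 - P) * Z * (1 - Q) * Zᵀ) = trace (C * Cᵀ) - trace (P * C * (P * C)ᵀ) := by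
    rw [trace_sandwich_eq Z hPs hPi hQs hQi]
    generalize (1 - P) * Z * (1 - Q) = B at hBU
    have h1 : B * Bᵀ = (1 - P) * C * ((1 - P) * C)ᵀ := by
      rw [← hBU, transpose_mul, Matrix.mul_assoc B, ← Matrix.mul_assoc U, hU', Matrix.one_mul]
    have h2 (K : Matrix (Fin N) (Fin N) ℝ) (hs : Kᵀ = K) (hi : K * K = K) :
        trace (K * C * (K * C)ᵀ) = trace (K * (C * Cᵀ)) := by
      rw [transpose_mul, hs, ← Matrix.mul_assoc, trace_mul_comm]
      simp only [← Matrix.mul_assoc]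
      rw [hi]
    rw [h1, h2 _ (by simp [hPs]) (one_sub_mul_one_sub_self hPi), h2 _ hPs hPi, Matrix.sub_mul,
      Matrix.one_mul, trace_sub]
  have hCC : trace (C * Cᵀ)
      = ∑ i ∈ Finset.univ.filter (fun i : Fin T => R₁ + R₂ ≤ (i : ℕ)), mu (Zᵀ * Z) i := by
    have h1 : Cᵀ * C = diagonal t * (Uᵀ * (Zᵀ * Z) * U) * diagonal t := by
      simp [hC, Matrix.mul_assoc]
    rw [trace_mul_comm, h1, hD, diagonal_mul_diagonal, diagonal_mul_diagonal, trace_diagonal,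
      Finset.sum_filter]
    refine Finset.sum_congr rfl fun i _ => ?_
    simp only [ht]
    split_ifs <;> simp
  rw [hBB, hCC]
  linarith [trace_mul_transpose_self_nonneg (P * C)]

/-- For `R = R₁ + R₂ ≤ min(N,T)`, the infimum over `N×R₁` matrices `λ̃` and `T×R₂`
matrices `f̃` of `Tr(M_λ̃ Z M_f̃ Zᵀ)` equals the sum of the `T − R` smallest eigenvalues
of `ZᵀZ`, and the infimum is attained. -/
theorem statement3 (N T R₁ R₂ : ℕ) (hRN : R₁ + R₂ ≤ N) (hRT : R₁ + R₂ ≤ T)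
    (Z : Matrix (Fin N) (Fin T) ℝ) :
    IsLeast {x : ℝ | ∃ (l : Matrix (Fin N) (Fin R₁) ℝ) (f : Matrix (Fin T) (Fin R₂) ℝ)
        (P : Matrix (Fin N) (Fin N) ℝ) (Q : Matrix (Fin T) (Fin T) ℝ),
        IsProjOnto l P ∧ IsProjOnto f Q ∧
        x = Matrix.trace ((1 - P) * Z * (1 - Q) * Zᵀ)}
      (∑ i ∈ Finset.univ.filter (fun i : Fin T => R₁ + R₂ ≤ (i : ℕ)), mu (Zᵀ * Z) i) := by
  refine ⟨?_, ?_⟩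
  · obtain ⟨l, f, P, Q, hP, hQ, h⟩ := exists_trace_sandwich_le hRT Z
    exact ⟨l, f, P, Q, hP, hQ, le_antisymm (sum_tail_mu_le_trace_sandwich hRT Z hP hQ) h⟩
  · rintro x ⟨l, f, P, Q, hP, hQ, rfl⟩
    exact sum_tail_mu_le_trace_sandwich hRT Z hP hQ
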